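/- Let X be a real n × K matrix with linearly independent columns, let D be an n × n diagonal matrix whose diagonal entries lie in (0, 1], and let η > 0. Define the projection matrices Π_D := X (Xᵀ D X)⁻¹ Xᵀ D and Π^η_D := X (Xᵀ D X + ηI)⁻¹ Xᵀ D. Then ‖Π^η_D − Π_D‖ ≤ (σ_max(X)² / (σ_min(X)⁴ σ_min(D)^{2.5})) · η, where σ_max(·) and σ_min(·) denote the largest and smallest singular values. -/

import Mathlib

open Matrix

/-- The operator norm of a real matrix induced by the Euclidean norms
(i.e., its largest singular value). -/
noncomputable def opNorm {m n : Type*} [Fintype m] [Fintype n] [DecidableEq n]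
    (M : Matrix m n ℝ) : ℝ :=
  ‖LinearMap.toContinuousLinearMap (Matrix.toEuclideanLin M)‖

/-- The Euclidean norm of a plain vector. -/
noncomputable def evnorm {n : Type*} [Fintype n] (v : n → ℝ) : ℝ :=
  ‖(WithLp.equiv 2 (n → ℝ)).symm v‖

/-- The smallest singular value of a real matrix: the infimum of `‖Mv‖` over
Euclidean-unit vectors `v`. -/
noncomputable def sigmaMin {m n : Type*} [Fintype m] [Fintype n]
    (M : Matrix m n ℝ) : ℝ :=
  sInf {c : ℝ | ∃ v : n → ℝ, evnorm v = 1 ∧ c = evnorm (M.mulVec v)}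

lemma evnorm_sq {n : Type*} [Fintype n] (v : n → ℝ) : evnorm v ^ 2 = v ⬝ᵥ v := by
  unfold evnorm
  rw [EuclideanSpace.norm_sq_eq]
  simp [dotProduct, sq]

lemma evnorm_nonneg {n : Type*} [Fintype n] (v : n → ℝ) : 0 ≤ evnorm v := norm_nonneg _

lemma evnorm_pos {n : Type*} [Fintype n] {v : n → ℝ} (hv : v ≠ 0) : 0 < evnorm v := by
  unfold evnorm
  rw [norm_pos_iff]
  simpa using hv

lemma evnorm_smul {n : Type*} [Fintype n] (c : ℝ) (v : n → ℝ) :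
    evnorm (c • v) = |c| * evnorm v := by
  have : (WithLp.equiv 2 (n → ℝ)).symm (c • v) = c • (WithLp.equiv 2 (n → ℝ)).symm v := rfl
  unfold evnorm
  rw [this, norm_smul, Real.norm_eq_abs]

lemma dot_le {n : Type*} [Fintype n] (v w : n → ℝ) : v ⬝ᵥ w ≤ evnorm v * evnorm w := by
  have h := Finset.sum_mul_sq_le_sq_mul_sq Finset.univ v w
  have hv := evnorm_sq v
  have hw := evnorm_sq w
  apply le_of_sq_le_sq₀' (evnorm_nonneg v) (evnorm_nonneg w)
  rw [hv, hw]
  simpa [dotProduct, sq] using h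
where
  le_of_sq_le_sq₀' {a b c : ℝ} (hb : 0 ≤ b) (hc : 0 ≤ c) (h : a ^ 2 ≤ b ^ 2 * c ^ 2) :
      a ≤ b * c := by
    apply le_of_abs_le
    rw [← abs_of_nonneg (mul_nonneg hb hc)]
    apply sq_le_sq.mp
    rw [mul_pow]; exact h

lemma opNorm_bound {m n : Type*} [Fintype m] [Fintype n] [DecidableEq n]
    (M : Matrix m n ℝ) (v : n → ℝ) : evnorm (M *ᵥ v) ≤ opNorm M * evnorm v :=
  (LinearMap.toContinuousLinearMap (Matrix.toEuclideanLin M)).le_opNorm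
    ((WithLp.equiv 2 (n → ℝ)).symm v)

lemma opNorm_le {m n : Type*} [Fintype m] [Fintype n] [DecidableEq n]
    (M : Matrix m n ℝ) (C : ℝ) (hC : 0 ≤ C) (h : ∀ v, evnorm (M *ᵥ v) ≤ C * evnorm v) :
    opNorm M ≤ C :=
  ContinuousLinearMap.opNorm_le_bound _ hC fun x => h (WithLp.equiv 2 (n → ℝ) x)

lemma sigmaMin_le {m n : Type*} [Fintype m] [Fintype n]
    (M : Matrix m n ℝ) (v : n → ℝ) : sigmaMin M * evnorm v ≤ evnorm (M *ᵥ v) := by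
  by_cases hv : v = 0
  · subst hv
    have : evnorm (0 : n → ℝ) = 0 := by
      have := evnorm_sq (0 : n → ℝ)
      simpa using this
    rw [this, mul_zero]; exact evnorm_nonneg _
  have hp := evnorm_pos hv
  have : sigmaMin M ≤ evnorm (M *ᵥ ((evnorm v)⁻¹ • v)) := by
    apply csInf_le
    · refine ⟨0, ?_⟩
      rintro c ⟨w, -, rfl⟩
      exact evnorm_nonneg _
    · refine ⟨_, ?_, rfl⟩
      rw [evnorm_smul, abs_of_pos (inv_pos.mpr hp), inv_mul_cancel₀ hp.ne']
  rw [mulVec_smul, evnorm_smul, abs_of_pos (inv_pos.mpr hp)] at this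
  calc _ ≤ _ := mul_le_mul_of_nonneg_right this hp.le
    _ = _ := by field_simp

lemma sigmaMin_pos {m n : Type*} [Fintype m] [Fintype n] [DecidableEq n] [Nonempty n]
    (M : Matrix m n ℝ) (h : Function.Injective M.mulVec) : 0 < sigmaMin M := by
  have hk : LinearMap.ker (Matrix.toEuclideanLin M) = ⊥ := by
    rw [LinearMap.ker_eq_bot]
    intro x y hxy
    have h1 : M *ᵥ (WithLp.equiv 2 (n → ℝ) x) = M *ᵥ (WithLp.equiv 2 (n → ℝ) y) :=
      congrArg (WithLp.equiv 2 (m → ℝ)) hxy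
    exact (WithLp.equiv 2 (n → ℝ)).injective (h h1)
  obtain ⟨k, hk0, hk⟩ := (Matrix.toEuclideanLin M).exists_antilipschitzWith hk
  have hk0' : (0 : ℝ) < k := hk0
  refine lt_of_lt_of_le (inv_pos.mpr hk0') ?_
  apply le_csInf
  · obtain ⟨i⟩ := ‹Nonempty n›
    refine ⟨_, Pi.single i 1, ?_, rfl⟩
    have := evnorm_sq (Pi.single i (1 : ℝ))
    simp at this
    rcases this with h | h
    · exact h
    · linarith [evnorm_nonneg (Pi.single i (1 : ℝ))]
  · rintro c ⟨v, hv, rfl⟩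
    have := hk.le_mul_dist ((WithLp.equiv 2 (n → ℝ)).symm v) 0
    rw [map_zero, dist_zero_right, dist_zero_right] at this
    change evnorm v ≤ k * evnorm (M *ᵥ v) at this
    rw [hv] at this
    rw [inv_le_iff_one_le_mul₀ hk0']
    linarith

/-- bound on the distance between the ridge-regularized projection
`Π^η_D = X(XᵀDX + ηI)⁻¹XᵀD` and the projection `Π_D = X(XᵀDX)⁻¹XᵀD`. -/
theorem regularized_projection_bound {n K : ℕ}
    (X : Matrix (Fin n) (Fin K) ℝ)
    (hX : LinearIndependent ℝ (fun j : Fin K => fun i : Fin n => X i j))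
    (d : Fin n → ℝ) (hd0 : ∀ i, 0 < d i) (hd1 : ∀ i, d i ≤ 1)
    {η : ℝ} (hη : 0 < η)
    (D : Matrix (Fin n) (Fin n) ℝ) (hD : D = Matrix.diagonal d) :
    opNorm (X * (Xᵀ * D * X + η • (1 : Matrix (Fin K) (Fin K) ℝ))⁻¹ * Xᵀ * D -
        X * (Xᵀ * D * X)⁻¹ * Xᵀ * D) ≤
      opNorm X ^ 2 / (sigmaMin X ^ 4 * sigmaMin D ^ (2.5 : ℝ)) * η := by
  have hinj : Function.Injective X.mulVec := Matrix.mulVec_injective_iff.mpr hX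
  rcases Nat.eq_zero_or_pos K with rfl | hK
  · have h0 : ∀ M : Matrix (Fin 0) (Fin 0) ℝ, X * M = 0 := by
      intro M; ext i j; exact j.elim0
    have hX0 : opNorm X = 0 := by
      apply le_antisymm _ (norm_nonneg _)
      apply opNorm_le _ _ le_rfl
      intro v
      have : X *ᵥ v = (0 : ℝ) • (0 : Fin n → ℝ) := by ext i; simp [mulVec, dotProduct]
      rw [this, evnorm_smul]; simp
    rw [h0, h0, hX0]
    simp [opNorm]
  have : Nonempty (Fin K) := ⟨⟨0, hK⟩⟩
  have hn : Nonempty (Fin n) := by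
    by_contra hne
    rw [not_nonempty_iff] at hne
    have := hinj (a₁ := fun _ => 1) (a₂ := fun _ => 0) (Subsingleton.elim _ _)
    have := congrFun this ⟨0, hK⟩
    simp at this
  have hs := sigmaMin_pos X hinj
  have hDv : ∀ v i, (D *ᵥ v) i = d i * v i := by
    intro v i; rw [hD, mulVec_diagonal]
  have hδ : 0 < sigmaMin D := by
    apply sigmaMin_pos
    intro v w h
    ext i
    have := congrFun h i
    rw [hDv, hDv] at this
    exact mul_left_cancel₀ (hd0 i).ne' this
  have hδd : ∀ i, sigmaMin D ≤ d i := by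
    intro i
    have h1 := sigmaMin_le D (Pi.single i 1)
    have h2 : D *ᵥ (Pi.single i 1) = d i • (Pi.single i (1:ℝ) : Fin n → ℝ) := by
      ext j; rw [hDv]; by_cases hj : j = i
      · subst hj; simp
      · simp [hj]
    rw [h2, evnorm_smul, abs_of_pos (hd0 i)] at h1
    exact le_of_mul_le_mul_right h1 (evnorm_pos (by simp))
  have hSs : sigmaMin X ≤ opNorm X := by
    have hne : (fun _ => 1 : Fin K → ℝ) ≠ 0 := fun h => by
      have := congrFun h ⟨0, hK⟩
      simp at this
    exact le_of_mul_le_mul_right ((sigmaMin_le X _).trans (opNorm_bound X _)) (evnorm_pos hne)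
  set s := sigmaMin X
  set δ := sigmaMin D
  set S := opNorm X
  have hδ1 : δ ≤ 1 := (hδd hn.some).trans (hd1 _)
  -- quadratic form bounds
  have hq : ∀ v : Fin n → ℝ, δ * evnorm v ^ 2 ≤ v ⬝ᵥ (D *ᵥ v) := by
    intro v
    rw [evnorm_sq, dotProduct, dotProduct, Finset.mul_sum]
    apply Finset.sum_le_sum
    intro i _
    rw [hDv]
    nlinarith [hδd i, mul_self_nonneg (v i)]
  have hD1 : ∀ v, evnorm (D *ᵥ v) ≤ evnorm v := by
    intro v
    apply le_of_sq_le_sq _ (evnorm_nonneg _)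
    rw [evnorm_sq, evnorm_sq]
    apply Finset.sum_le_sum
    intro i _
    rw [hDv]
    have h1 : d i * d i ≤ 1 := by nlinarith [hd0 i, hd1 i]
    nlinarith [mul_self_nonneg (v i)]
  set A := Xᵀ * D * X with hA
  have hAq : ∀ v, v ⬝ᵥ (A *ᵥ v) = (X *ᵥ v) ⬝ᵥ (D *ᵥ (X *ᵥ v)) := by
    intro v
    rw [hA, ← mulVec_mulVec, ← mulVec_mulVec, dotProduct_mulVec, vecMul_transpose]
  have hAlow : ∀ v, δ * s ^ 2 * evnorm v ^ 2 ≤ v ⬝ᵥ (A *ᵥ v) := by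
    intro v
    rw [hAq]
    refine le_trans ?_ (hq _)
    have h1 := sigmaMin_le X v
    have h2 : (s * evnorm v) ^ 2 ≤ evnorm (X *ᵥ v) ^ 2 :=
      pow_le_pow_left₀ (mul_nonneg hs.le (evnorm_nonneg v)) h1 2
    nlinarith
  set B := A + η • (1 : Matrix (Fin K) (Fin K) ℝ) with hB
  have hBlow : ∀ v, δ * s ^ 2 * evnorm v ^ 2 ≤ v ⬝ᵥ (B *ᵥ v) := by
    intro v
    have : v ⬝ᵥ (B *ᵥ v) = v ⬝ᵥ (A *ᵥ v) + η * evnorm v ^ 2 := by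
      rw [hB, add_mulVec, dotProduct_add, smul_mulVec, one_mulVec, dotProduct_smul, evnorm_sq,
        smul_eq_mul]
    rw [this]
    have := hAlow v
    have := mul_nonneg hη.le (sq_nonneg (evnorm v))
    linarith
  have hunit : ∀ M : Matrix (Fin K) (Fin K) ℝ,
      (∀ v, δ * s ^ 2 * evnorm v ^ 2 ≤ v ⬝ᵥ (M *ᵥ v)) → IsUnit M.det := by
    intro M hM
    rw [← Matrix.isUnit_iff_isUnit_det, ← Matrix.mulVec_injective_iff_isUnit]
    intro v w hvw
    by_contra hne
    have h1 := hM (v - w)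
    have h2 : M *ᵥ (v - w) = 0 := by rw [mulVec_sub]; exact sub_eq_zero.mpr hvw
    rw [h2, dotProduct_zero] at h1
    have := evnorm_pos (sub_ne_zero.mpr hne)
    have : 0 < δ * s ^ 2 * evnorm (v - w) ^ 2 := by positivity
    linarith
  have hAu := hunit A hAlow
  have hBu := hunit B hBlow
  have hdiff : B⁻¹ - A⁻¹ = -η • (B⁻¹ * A⁻¹) := by
    have h1 : B⁻¹ * (A - B) * A⁻¹ = B⁻¹ - A⁻¹ := by
      rw [mul_sub, sub_mul, Matrix.nonsing_inv_mul B hBu, Matrix.mul_assoc,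
        Matrix.mul_nonsing_inv A hAu, mul_one, one_mul]
    rw [← h1, hB]
    simp
  have hmain : X * B⁻¹ * Xᵀ * D - X * A⁻¹ * Xᵀ * D = -η • (X * (B⁻¹ * (A⁻¹ * (Xᵀ * D)))) := by
    have : X * B⁻¹ * Xᵀ * D - X * A⁻¹ * Xᵀ * D = X * (B⁻¹ - A⁻¹) * Xᵀ * D := by
      simp only [mul_sub, Matrix.mul_sub, Matrix.sub_mul]
    rw [this, hdiff]
    simp only [Matrix.mul_smul, Matrix.smul_mul, Matrix.mul_assoc]
  rw [hmain]
  have hpd : 0 < δ ^ (2.5 : ℝ) := Real.rpow_pos_of_pos hδ _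
  have hpd2 : δ ^ (2.5 : ℝ) ≤ δ ^ 2 := by
    rw [← Real.rpow_natCast]
    exact Real.rpow_le_rpow_of_exponent_ge hδ hδ1 (by norm_num)
  apply opNorm_le _ _ (by positivity)
  intro y
  rw [smul_mulVec, evnorm_smul, abs_neg, abs_of_pos hη, ← mulVec_mulVec, ← mulVec_mulVec,
    ← mulVec_mulVec, ← mulVec_mulVec]
  set w := A⁻¹ *ᵥ (Xᵀ *ᵥ (D *ᵥ y)) with hw
  set z := B⁻¹ *ᵥ w with hz
  have hAw : A *ᵥ w = Xᵀ *ᵥ (D *ᵥ y) := by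
    rw [hw, mulVec_mulVec, Matrix.mul_nonsing_inv A hAu, one_mulVec]
  have hBz : B *ᵥ z = w := by
    rw [hz, mulVec_mulVec, Matrix.mul_nonsing_inv B hBu, one_mulVec]
  have cancel : ∀ a b c : ℝ, 0 ≤ a → 0 ≤ b → c * a ^ 2 ≤ a * b → c * a ≤ b := by
    intro a b c ha hb h
    rcases ha.eq_or_lt with h0 | h0
    · rw [← h0]; simpa using hb
    · exact le_of_mul_le_mul_left (by nlinarith) h0
  have e1 : δ * evnorm (X *ᵥ w) ≤ evnorm y := by
    apply cancel _ _ _ (evnorm_nonneg _) (evnorm_nonneg _)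
    have h1 := hq (X *ᵥ w)
    rw [← hAq, hAw, dotProduct_mulVec, vecMul_transpose] at h1
    refine h1.trans ((dot_le _ _).trans ?_)
    exact mul_le_mul_of_nonneg_left (hD1 y) (evnorm_nonneg _)
  have e2 : s * evnorm w ≤ evnorm (X *ᵥ w) := sigmaMin_le X w
  have e3 : δ * s ^ 2 * evnorm z ≤ evnorm w := by
    apply cancel _ _ _ (evnorm_nonneg _) (evnorm_nonneg _)
    have h1 := hBlow z
    rw [hBz] at h1
    exact h1.trans (dot_le _ _)
  have e4 : evnorm (X *ᵥ z) ≤ S * evnorm z := opNorm_bound X z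
  have hz0 := evnorm_nonneg z
  have e5 : s ^ 3 * δ ^ 2 * evnorm z ≤ evnorm y := by
    calc s ^ 3 * δ ^ 2 * evnorm z = δ * (s * (δ * s ^ 2 * evnorm z)) := by ring
      _ ≤ δ * (s * evnorm w) := by gcongr
      _ ≤ δ * evnorm (X *ᵥ w) := by gcongr
      _ ≤ _ := e1
  have hS : 0 < S := hs.trans_le hSs
  have e6 : evnorm (X *ᵥ z) * (s ^ 4 * δ ^ (2.5 : ℝ)) ≤ S ^ 2 * evnorm y := by
    calc evnorm (X *ᵥ z) * (s ^ 4 * δ ^ (2.5 : ℝ)) ≤ (S * evnorm z) * (s ^ 4 * δ ^ 2) := by gcongr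
      _ = S * s * (s ^ 3 * δ ^ 2 * evnorm z) := by ring
      _ ≤ S * S * evnorm y := by gcongr
      _ = _ := by ring
  have e7 : evnorm (X *ᵥ z) ≤ S ^ 2 * evnorm y / (s ^ 4 * δ ^ (2.5 : ℝ)) := by
    rw [le_div_iff₀ (by positivity)]; exact e6
  calc η * evnorm (X *ᵥ z) ≤ η * (S ^ 2 * evnorm y / (s ^ 4 * δ ^ (2.5 : ℝ))) := by gcongr
    _ = _ := by ring
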